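/- Let U ⊆ ℝ² be open and φ : U → ℝ³ a smooth map with Q(φ(u,v)) ≠ 0 for all (u,v) ∈ U, and set ψ = φ/Q(φ). Then B(ψ_u, ψ_v)² − B(ψ_u, ψ_u)·B(ψ_v, ψ_v) = ( B(φ_u, φ_v)² − B(φ_u, φ_u)·B(φ_v, φ_v) ) / Q(φ)⁴; in particular the metric induced by B on the image of ψ is degenerate at (u,v) if and only if it is degenerate at (u,v) for φ (the Möbius inversion preserves the locus of degeneracy LD). -/

import Mathlib

noncomputable section

/-- The Minkowski bilinear form on `ℝ³`. -/
def B (p q : EuclideanSpace ℝ (Fin 3)) : ℝ := p 0 * q 0 + p 1 * q 1 - p 2 * q 2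

/-- The Minkowski quadratic form. -/
def Q (p : EuclideanSpace ℝ (Fin 3)) : ℝ := B p p

/-- The Möbius inversion `i_M(p) = p / Q(p)`. -/
def iM (p : EuclideanSpace ℝ (Fin 3)) : EuclideanSpace ℝ (Fin 3) := (Q p)⁻¹ • p

/-- Partial derivative with respect to the first variable. -/
def pdu (χ : ℝ × ℝ → EuclideanSpace ℝ (Fin 3)) (x : ℝ × ℝ) : EuclideanSpace ℝ (Fin 3) :=
  fderiv ℝ χ x (1, 0)

/-- Partial derivative with respect to the second variable. -/
def pdv (χ : ℝ × ℝ → EuclideanSpace ℝ (Fin 3)) (x : ℝ × ℝ) : EuclideanSpace ℝ (Fin 3) :=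
  fderiv ℝ χ x (0, 1)

theorem hasFDerivAt_Q (p : EuclideanSpace ℝ (Fin 3)) :
    ∃ L : EuclideanSpace ℝ (Fin 3) →L[ℝ] ℝ, HasFDerivAt Q L p ∧ ∀ w, L w = 2 * B p w := by
  have h (i : Fin 3) := (EuclideanSpace.proj i : EuclideanSpace ℝ (Fin 3) →L[ℝ] ℝ).hasFDerivAt
    (x := p)
  refine ⟨_, (((h 0).mul (h 0)).add ((h 1).mul (h 1))).sub ((h 2).mul (h 2)), fun w => ?_⟩
  simp [B]
  ring

/-- The differential of the Möbius inversion along a curve or surface. -/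
theorem fderiv_iM_comp {E : Type*} [NormedAddCommGroup E] [NormedSpace ℝ E]
    {φ : E → EuclideanSpace ℝ (Fin 3)} {x : E} (hφ : DifferentiableAt ℝ φ x)
    (hQ : Q (φ x) ≠ 0) (w : E) :
    fderiv ℝ (fun y => iM (φ y)) x w =
      (Q (φ x))⁻¹ • fderiv ℝ φ x w -
        (2 * B (φ x) (fderiv ℝ φ x w) / Q (φ x) ^ 2) • φ x := by
  obtain ⟨L, hL, hLw⟩ := hasFDerivAt_Q (φ x)
  have hinv := (hasDerivAt_inv hQ).comp_hasFDerivAt x (hL.comp x hφ.hasFDerivAt)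
  have h := hinv.smul hφ.hasFDerivAt
  have h' : HasFDerivAt (fun y => iM (φ y)) _ x := h
  rw [h'.fderiv]
  simp [hLw, sub_eq_add_neg, ← neg_smul]
  ring_nf

/-- The Möbius inversion is conformal: its differential scales `B` by `1 / Q ^ 2`. -/
theorem B_inversion_differential (p a b : EuclideanSpace ℝ (Fin 3)) (hp : Q p ≠ 0) :
    B ((Q p)⁻¹ • a - (2 * B p a / Q p ^ 2) • p) ((Q p)⁻¹ • b - (2 * B p b / Q p ^ 2) • p) =
      B a b / Q p ^ 2 := by
  have expand (r s t u : ℝ) : B (r • a - s • p) (t • b - u • p) =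
      r * t * B a b - r * u * B p a - s * t * B p b + s * u * Q p := by
    simp [B, Q]
    ring
  rw [expand]
  field_simp
  ring

theorem stmt_8 (U : Set (ℝ × ℝ)) (hU : IsOpen U)
    (φ ψ : ℝ × ℝ → EuclideanSpace ℝ (Fin 3))
    (hφ : ContDiffOn ℝ (⊤ : ℕ∞) φ U) (hQ : ∀ x ∈ U, Q (φ x) ≠ 0)
    (hψ : ∀ x, ψ x = iM (φ x)) (x : ℝ × ℝ) (hx : x ∈ U) :
    B (pdu ψ x) (pdv ψ x) ^ 2 - B (pdu ψ x) (pdu ψ x) * B (pdv ψ x) (pdv ψ x) =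
      (B (pdu φ x) (pdv φ x) ^ 2 - B (pdu φ x) (pdu φ x) * B (pdv φ x) (pdv φ x)) /
        Q (φ x) ^ 4 ∧
    (B (pdu ψ x) (pdv ψ x) ^ 2 - B (pdu ψ x) (pdu ψ x) * B (pdv ψ x) (pdv ψ x) = 0 ↔
      B (pdu φ x) (pdv φ x) ^ 2 - B (pdu φ x) (pdu φ x) * B (pdv φ x) (pdv φ x) = 0) := by
  have hd : DifferentiableAt ℝ φ x :=
    (hφ.contDiffAt (hU.mem_nhds hx)).differentiableAt (by simp)
  obtain rfl : ψ = fun y => iM (φ y) := funext hψ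
  have hQx := hQ x hx
  have key : B (pdu (fun y => iM (φ y)) x) (pdv (fun y => iM (φ y)) x) ^ 2 -
      B (pdu (fun y => iM (φ y)) x) (pdu (fun y => iM (φ y)) x) *
        B (pdv (fun y => iM (φ y)) x) (pdv (fun y => iM (φ y)) x) =
      (B (pdu φ x) (pdv φ x) ^ 2 - B (pdu φ x) (pdu φ x) * B (pdv φ x) (pdv φ x)) /
        Q (φ x) ^ 4 := by
    simp only [pdu, pdv, fderiv_iM_comp hd hQx, B_inversion_differential _ _ _ hQx]
    field_simp
  refine ⟨key, ?_⟩
  rw [key, div_eq_zero_iff]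
  simp [hQx]
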